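/- Let C be a family of 6-element subsets of a finite set such that any two distinct members intersect in exactly 3 elements. If there is no 3-element set contained in every member of C, then |C| ≤ 13. -/

import Mathlib

open Finset in
theorem aux_norm {α : Type*} [DecidableEq α] (C : Finset (Finset α))
    (hcard : ∀ w ∈ C, w.card = 6)
    (hint : ∀ u ∈ C, ∀ w ∈ C, u ≠ w → (u ∩ w).card = 3)
    (c : Finset α → ℤ) (h0 : ∑ v ∈ C, c v = 0) :
    ∑ y ∈ C.biUnion id, (∑ v ∈ C, if y ∈ v then c v else 0) ^ 2 = 3 * ∑ v ∈ C, c v ^ 2 := by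
  have h1 : ∀ u ∈ C, ∀ v ∈ C, (∑ y ∈ C.biUnion id,
      (if y ∈ u then c u else 0) * (if y ∈ v then c v else 0))
      = 3 * (c u * c v) + if u = v then 3 * (c u * c v) else 0 := by
    intro u hu v hv
    have e : ∀ y, (if y ∈ u then c u else 0) * (if y ∈ v then c v else 0)
        = if y ∈ u ∩ v then c u * c v else 0 := by
      intro y
      by_cases a : y ∈ u <;> by_cases b : y ∈ v <;> simp [a, b]
    simp_rw [e]
    rw [← Finset.sum_filter, Finset.sum_const]
    have : (C.biUnion id).filter (fun y => y ∈ u ∩ v) = u ∩ v := by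
      ext y
      simp only [mem_filter, mem_biUnion, id, mem_inter]
      exact ⟨fun h => h.2, fun h => ⟨⟨u, hu, h.1⟩, h⟩⟩
    rw [this]
    by_cases huv : u = v
    · subst huv
      simp [hcard u hu]
      ring
    · simp [hint u hu v hv huv, huv]
  calc _ = ∑ y ∈ C.biUnion id, ∑ u ∈ C, ∑ v ∈ C,
      (if y ∈ u then c u else 0) * (if y ∈ v then c v else 0) := by
        refine Finset.sum_congr rfl fun y _ => ?_
        rw [sq, Finset.sum_mul_sum]
    _ = ∑ u ∈ C, ∑ v ∈ C, ∑ y ∈ C.biUnion id,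
      (if y ∈ u then c u else 0) * (if y ∈ v then c v else 0) := by
        rw [Finset.sum_comm]
        refine Finset.sum_congr rfl fun y _ => ?_
        rw [Finset.sum_comm]
    _ = ∑ u ∈ C, ∑ v ∈ C, (3 * (c u * c v) + if u = v then 3 * (c u * c v) else 0) :=
        Finset.sum_congr rfl fun u hu => Finset.sum_congr rfl fun v hv => h1 u hu v hv
    _ = ∑ u ∈ C, 3 * c u ^ 2 := by
        refine Finset.sum_congr rfl fun u hu => ?_
        rw [Finset.sum_add_distrib, ← Finset.mul_sum, ← Finset.mul_sum, h0]
        simp [hu]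
        ring
    _ = _ := by rw [Finset.mul_sum]

open Finset in
theorem aux_deg {α : Type*} [DecidableEq α] (C : Finset (Finset α))
    (hcard : ∀ w ∈ C, w.card = 6)
    (hint : ∀ u ∈ C, ∀ w ∈ C, u ≠ w → (u ∩ w).card = 3) (hC : C.card = 14) (x : α) :
    #{v ∈ C | x ∈ v} ≤ 4 ∨ 10 ≤ #{v ∈ C | x ∈ v} := by
  by_contra! hcon
  set d := #{v ∈ C | x ∈ v} with hd
  have hd2 : #{v ∈ C | x ∉ v} = 14 - d := by
    have := Finset.card_filter_add_card_filter_not (s := C) (fun v => x ∈ v)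
    omega
  have key := aux_norm C hcard hint (fun v => if x ∈ v then (14 - d : ℤ) else -d) (by
    rw [Finset.sum_ite, Finset.sum_const, Finset.sum_const, hd2, ← hd]
    simp only [nsmul_eq_mul]
    push_cast [show d ≤ 14 by omega]
    ring)
  have hR : ∑ v ∈ C, (if x ∈ v then (14 - d : ℤ) else -d) ^ 2
      = d * (14 - d) ^ 2 + (14 - d) * d ^ 2 := by
    simp_rw [ite_pow]
    rw [Finset.sum_ite, Finset.sum_const, Finset.sum_const, hd2, ← hd]
    simp only [nsmul_eq_mul]
    push_cast [show d ≤ 14 by omega]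
    ring
  rw [hR] at key
  have hxU : x ∈ C.biUnion id := by
    have : 0 < #{v ∈ C | x ∈ v} := by omega
    obtain ⟨v, hv⟩ := Finset.card_pos.1 this
    rw [mem_filter] at hv
    exact mem_biUnion.2 ⟨v, hv⟩
  have hle := Finset.single_le_sum (f := fun y => (∑ v ∈ C, if y ∈ v then
    (if x ∈ v then (14 - d : ℤ) else -d) else 0) ^ 2) (fun y _ => sq_nonneg _) hxU
  rw [key] at hle
  have hx : (∑ v ∈ C, if x ∈ v then (if x ∈ v then (14 - d : ℤ) else -d) else 0)
      = d * (14 - d) := by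
    rw [← Finset.sum_filter, Finset.sum_congr rfl (g := fun _ => (14 - d : ℤ))
      (fun v hv => by simp [(mem_filter.1 hv).2]), Finset.sum_const, ← hd]
    simp
  simp only [hx] at hle
  obtain ⟨h4, h10⟩ := hcon
  clear_value d
  interval_cases d <;> norm_num at hle

open Finset in
theorem aux_main {α : Type*} [DecidableEq α] (C : Finset (Finset α))
    (hcard : ∀ w ∈ C, w.card = 6)
    (hint : ∀ u ∈ C, ∀ w ∈ C, u ≠ w → (u ∩ w).card = 3) (hC : C.card = 14)
    (hnotriple : ¬ ∃ t : Finset α, t.card = 3 ∧ ∀ w ∈ C, t ⊆ w) : False := by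
  set d : α → ℕ := fun x => #{v ∈ C | x ∈ v} with hd
  have hdeg : ∀ x, d x ≤ 4 ∨ 10 ≤ d x := aux_deg C hcard hint hC
  have hd14 : ∀ x, d x ≤ 14 := fun x => hC ▸ card_filter_le _ _
  have dc : ∀ s : Finset α, ∑ x ∈ s, d x = ∑ v ∈ C, #(v ∩ s) := by
    intro s
    simp only [hd, card_filter]
    rw [Finset.sum_comm]
    refine Finset.sum_congr rfl fun v _ => ?_
    rw [← card_filter, inter_comm, filter_mem_eq_inter]
  have h45 : ∀ w ∈ C, ∑ x ∈ w, d x = 45 := by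
    intro w hw
    rw [dc, ← Finset.add_sum_erase _ _ hw, inter_self, hcard w hw,
      Finset.sum_congr rfl (g := fun _ => 3)
        (fun v hv => hint v (mem_of_mem_erase hv) w hw (ne_of_mem_erase hv))]
    simp [card_erase_of_mem hw, hC]
  set H := (C.biUnion id).filter (fun x => 10 ≤ d x) with hH
  have hHd : ∀ x ∈ H, 10 ≤ d x := fun x hx => (mem_filter.1 hx).2
  have hsplit : ∀ w ∈ C, ∑ x ∈ w ∩ H, d x + ∑ x ∈ w \ H, d x = 45 ∧
      #(w ∩ H) + #(w \ H) = 6 ∧ ∑ x ∈ w \ H, d x ≤ #(w \ H) * 4 ∧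
      #(w \ H) ≤ ∑ x ∈ w \ H, d x ∧ #(w ∩ H) * 10 ≤ ∑ x ∈ w ∩ H, d x ∧
      ∑ x ∈ w ∩ H, d x ≤ #(w ∩ H) * 14 := by
    intro w hw
    refine ⟨?_, ?_, ?_, ?_, ?_, ?_⟩
    · rw [← h45 w hw, Finset.sum_inter_add_sum_sdiff]
    · rw [← hcard w hw, card_inter_add_card_sdiff]
    · refine Finset.sum_le_card_nsmul _ _ _ fun x hx => ?_
      rw [mem_sdiff] at hx
      rcases hdeg x with h | h
      · exact h
      · exact (hx.2 (mem_filter.2 ⟨mem_biUnion.2 ⟨w, hw, hx.1⟩, h⟩)).elim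
    · have := Finset.card_nsmul_le_sum (w \ H) d 1 fun x hx => ?_
      · simpa using this
      · exact card_pos.2 ⟨w, mem_filter.2 ⟨hw, (mem_sdiff.1 hx).1⟩⟩
    · exact Finset.card_nsmul_le_sum _ _ _ fun x hx => hHd x (mem_inter.1 hx).2
    · exact Finset.sum_le_card_nsmul _ _ _ fun x _ => hd14 x
  have h34 : ∀ w ∈ C, #(w ∩ H) = 3 ∨ #(w ∩ H) = 4 := by
    intro w hw
    have := hsplit w hw
    omega
  set S := C.filter (fun w => #(w ∩ H) = 4) with hS
  have hSle : #S ≤ (#H).choose 4 := by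
    rw [← card_powersetCard]
    refine card_le_card_of_injOn (fun w => w ∩ H) ?_ ?_
    · intro w hw
      exact mem_coe.2 (mem_powersetCard.2 ⟨inter_subset_right, (mem_filter.1 hw).2⟩)
    · intro u hu v hv huv
      by_contra hne
      have h3 := hint u (mem_filter.1 hu).1 v (mem_filter.1 hv).1 hne
      have h4 := (mem_filter.1 hu).2
      have huv' : u ∩ H = v ∩ H := huv
      have : u ∩ H ⊆ u ∩ v := subset_inter inter_subset_left (huv' ▸ inter_subset_left)
      have := card_le_card this
      omega
  have hsum : ∑ x ∈ H, d x = 42 + #S := by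
    rw [dc, hS, card_filter, Finset.sum_congr rfl
      (g := fun v => 3 + if #(v ∩ H) = 4 then 1 else 0), Finset.sum_add_distrib]
    · simp [hC]
    · intro v hv
      rcases h34 v hv with h | h <;> simp [h]
  have hSC : #S ≤ 14 := hC ▸ card_filter_le _ _
  have hHs : #H * 10 ≤ ∑ x ∈ H, d x := Finset.card_nsmul_le_sum _ _ _ hHd
  have hne : C.Nonempty := by
    rw [← card_pos]; omega
  obtain ⟨w0, hw0⟩ := hne
  have hH3 : 3 ≤ #H := by
    have := card_le_card (inter_subset_right : w0 ∩ H ⊆ H)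
    rcases h34 w0 hw0 with h | h <;> omega
  have hH5 : #H ≤ 5 := by omega
  have hcase : #H = 3 ∨ #H = 4 ∨ #H = 5 := by omega
  rcases hcase with h | h | h
  · refine hnotriple ⟨H, h, fun w hw => ?_⟩
    have h1 : w ∩ H = H := eq_of_subset_of_card_le inter_subset_right (by
      rcases h34 w hw with h' | h' <;> omega)
    exact h1 ▸ inter_subset_left
  · rw [h] at hSle
    have hS1 : #S ≤ 1 := by simpa using hSle
    have hmiss : ∀ x ∈ H, ∀ w ∈ C, x ∉ w → d x ≤ 9 + #S := by
      intro x hx w hw hxw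
      have hsub : w ∩ H ⊆ H.erase x := fun y hy => by
        rw [mem_inter] at hy
        exact mem_erase.2 ⟨fun e => hxw (e ▸ hy.1), hy.2⟩
      have hce : #(H.erase x) = 3 := by rw [card_erase_of_mem hx, h]
      have heq : w ∩ H = H.erase x := eq_of_subset_of_card_le hsub (by
        rcases h34 w hw with h' | h' <;> omega)
      have hs := hsplit w hw
      rw [heq, hce] at hs
      have := Finset.add_sum_erase H d hx
      omega
    have heven : ∀ x ∈ H, #S = 1 ∧ Even (d x) ∨ d x = 14 := by
      intro x hx
      by_cases hm : ∃ w ∈ C, x ∉ w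
      · obtain ⟨w, hw, hxw⟩ := hm
        have h1 := hmiss x hx w hw hxw
        have h2 := hHd x hx
        left
        refine ⟨by omega, ?_⟩
        have : d x = 10 := by omega
        rw [this]; decide
      · push Not at hm
        right
        rw [← hC]
        simp only [hd]
        rw [filter_true_of_mem hm]
    have hE : Even (∑ x ∈ H, d x) := by
      refine Finset.even_sum _ fun x hx => ?_
      rcases heven x hx with h' | h'
      · exact h'.2
      · rw [h']; decide
    rw [hsum] at hE
    have hS0 : #S = 0 := by
      rcases hE with ⟨k, hk⟩
      omega
    have : ∑ x ∈ H, d x = ∑ x ∈ H, 14 := Finset.sum_congr rfl fun x hx => by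
      rcases heven x hx with h' | h'
      · omega
      · exact h'
    simp [h] at this
    omega
  · rw [h] at hSle
    have : Nat.choose 5 4 = 5 := by decide
    omega

theorem stmt_2 {α : Type*} [DecidableEq α] (C : Finset (Finset α))
    (hcard : ∀ w ∈ C, w.card = 6)
    (hint : ∀ u ∈ C, ∀ w ∈ C, u ≠ w → (u ∩ w).card = 3)
    (hnotriple : ¬ ∃ t : Finset α, t.card = 3 ∧ ∀ w ∈ C, t ⊆ w) :
    C.card ≤ 13 := by
  by_contra! hlt
  obtain ⟨u, hu, v, hv, huv⟩ := Finset.one_lt_card.1 (show 1 < C.card by omega)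
  have h3 := hint u hu v hv huv
  have hex : ∃ w ∈ C, ¬ u ∩ v ⊆ w := by
    by_contra! hall
    exact hnotriple ⟨u ∩ v, h3, hall⟩
  obtain ⟨w, hw, hnw⟩ := hex
  have hsub : ({u, v, w} : Finset (Finset α)) ⊆ C := by
    intro z hz
    simp only [Finset.mem_insert, Finset.mem_singleton] at hz
    rcases hz with rfl | rfl | rfl <;> assumption
  have hc3 : ({u, v, w} : Finset (Finset α)).card ≤ 14 := Finset.card_le_three.trans (by omega)
  obtain ⟨D, hD1, hD2, hD3⟩ := Finset.exists_subsuperset_card_eq hsub hc3 (show 14 ≤ C.card by omega)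
  refine aux_main D (fun z hz => hcard z (hD2 hz))
    (fun y hy z hz => hint y (hD2 hy) z (hD2 hz)) hD3 ?_
  rintro ⟨t, ht, hall⟩
  have hu' := hall u (hD1 (by simp))
  have hv' := hall v (hD1 (by simp))
  have hw' := hall w (hD1 (by simp))
  have : t = u ∩ v := Finset.eq_of_subset_of_card_le (Finset.subset_inter hu' hv') (by omega)
  exact hnw (this ▸ hw')
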